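/- Let r: X × Y → {0,1} be a crisp relation between finite sets and let μ, ν be probability distributions on X and Y respectively. Then there exist functions f: X → {0,1} and g: Y → {0,1} such that g(y) − f(x) ≤ r(x,y) for all x, y, and Σ_y ν(y) g(y) − Σ_x μ(x) f(x) ≥ inf { Σ_{(x,y)} ρ(x,y)·r(x,y) : ρ a coupling of μ and ν }. -/

import Mathlib

/-- A nonnegative matrix with marginals bounded by `μ` and `ν`, supported where `r` vanishes. -/
def IsZeroSubcoupling {X Y : Type*} [Fintype X] [Fintype Y] (r : X → Y → ℝ) (μ : X → ℝ)
    (ν : Y → ℝ) (σ : X → Y → ℝ) : Prop :=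
  (∀ x y, 0 ≤ σ x y) ∧ (∀ x y, r x y ≠ 0 → σ x y = 0) ∧
    (∀ x, ∑ y, σ x y ≤ μ x) ∧ ∀ y, ∑ x, σ x y ≤ ν y

namespace IsZeroSubcoupling

theorem sum_add_ite_row {X Y : Type*} [Fintype Y] [DecidableEq X] (σ : X → Y → ℝ)
    (x₀ : X) (d : Y → ℝ) (x : X) :
    ∑ y, (σ x y + if x = x₀ then d y else 0) =
      ∑ y, σ x y + if x = x₀ then ∑ y, d y else 0 := by
  rw [Finset.sum_add_distrib]
  split_ifs <;> simp

theorem sum_add_ite_col {X Y : Type*} [Fintype X] [DecidableEq X] (σ : X → Y → ℝ)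
    (x₀ : X) (d : Y → ℝ) (y : Y) :
    ∑ x, (σ x y + if x = x₀ then d y else 0) = ∑ x, σ x y + d y := by
  simp [Finset.sum_add_distrib]

variable {X Y : Type*} [Fintype X] [Fintype Y] {r : X → Y → ℝ} {μ : X → ℝ} {ν : Y → ℝ}

theorem isCompact_setOf (r : X → Y → ℝ) (μ : X → ℝ) (ν : Y → ℝ) :
    IsCompact {σ | IsZeroSubcoupling r μ ν σ} := by
  refine IsCompact.of_isClosed_subset
    (isCompact_Icc (a := (0 : X → Y → ℝ)) (b := fun x _ => μ x)) ?_ ?_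
  · simp only [IsZeroSubcoupling, Set.ofPred_and, Set.ofPred_forall]
    refine ((isClosed_iInter fun x => isClosed_iInter fun y => ?_).inter
      ((isClosed_iInter fun x => isClosed_iInter fun y => isClosed_iInter fun _ => ?_).inter
      ((isClosed_iInter fun x => ?_).inter (isClosed_iInter fun y => ?_))))
    · exact isClosed_le (by fun_prop) (by fun_prop)
    · exact isClosed_eq (by fun_prop) (by fun_prop)
    · exact isClosed_le (by fun_prop) (by fun_prop)
    · exact isClosed_le (by fun_prop) (by fun_prop)
  · rintro σ ⟨h0, -, hrow, -⟩
    exact ⟨fun x y => h0 x y, fun x y =>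
      (Finset.single_le_sum (fun y _ => h0 x y) (Finset.mem_univ y)).trans (hrow x)⟩

theorem add_ite_row [DecidableEq X] {σ : X → Y → ℝ} (hσ : IsZeroSubcoupling r μ ν σ) {x₀ : X}
    {d : Y → ℝ} (h0 : ∀ y, 0 ≤ σ x₀ y + d y) (hr : ∀ y, r x₀ y ≠ 0 → d y = 0)
    (hrow : ∑ y, σ x₀ y + ∑ y, d y ≤ μ x₀) (hcol : ∀ y, ∑ x, σ x y + d y ≤ ν y) :
    IsZeroSubcoupling r μ ν (fun x y => σ x y + if x = x₀ then d y else 0) := by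
  refine ⟨fun x y => ?_, fun x y hxy => ?_, fun x => ?_, fun y => ?_⟩
  · dsimp only
    split_ifs with h
    · exact h ▸ h0 y
    · simpa using hσ.1 x y
  · dsimp only
    split_ifs with h
    · subst h
      rw [hσ.2.1 x y hxy, hr y hxy, add_zero]
    · rw [hσ.2.1 x y hxy, add_zero]
  · rw [sum_add_ite_row]
    split_ifs with h
    · exact h ▸ hrow
    · simpa using hσ.2.2.1 x
  · rw [sum_add_ite_col]
    exact hcol y

/-- A subcoupling of maximal mass whose set of unsaturated columns is inclusion-maximal. -/
theorem exists_max (r : X → Y → ℝ) (hμ0 : ∀ x, 0 ≤ μ x) (hν0 : ∀ y, 0 ≤ ν y) :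
    ∃ σ, IsZeroSubcoupling r μ ν σ ∧
      (∀ τ, IsZeroSubcoupling r μ ν τ → ∑ x, ∑ y, τ x y ≤ ∑ x, ∑ y, σ x y) ∧
      ∀ τ, IsZeroSubcoupling r μ ν τ → ∑ x, ∑ y, τ x y = ∑ x, ∑ y, σ x y →
        {y | ∑ x, σ x y < ν y} ⊆ {y | ∑ x, τ x y < ν y} →
        {y | ∑ x, τ x y < ν y} ⊆ {y | ∑ x, σ x y < ν y} := by
  obtain ⟨σ₀, hσ₀, hmax⟩ := (isCompact_setOf r μ ν).exists_isMaxOn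
    ⟨0, by simp [IsZeroSubcoupling, hμ0, hν0]⟩
    (f := fun σ => ∑ x, ∑ y, σ x y) (by fun_prop)
  obtain ⟨B, ⟨σ, ⟨hσ, hm⟩, rfl⟩, hB⟩ :=
    (Set.toFinite ((fun σ : X → Y → ℝ => {y | ∑ x, σ x y < ν y}) ''
      {σ | IsZeroSubcoupling r μ ν σ ∧ ∑ x, ∑ y, σ x y = ∑ x, ∑ y, σ₀ x y})).exists_maximal
      ⟨_, σ₀, ⟨hσ₀, rfl⟩, rfl⟩
  exact ⟨σ, hσ, fun τ hτ => hm ▸ hmax hτ, fun τ hτ hτm hsub =>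
    hB ⟨τ, ⟨hτ, hτm.trans hm⟩, rfl⟩ hsub⟩

/-- Max-flow min-cut for bipartite transport along the zero set of `r`. -/
theorem exists_mass_eq_cut (r : X → Y → ℝ) (hμ0 : ∀ x, 0 ≤ μ x) (hν0 : ∀ y, 0 ≤ ν y) :
    ∃ σ, IsZeroSubcoupling r μ ν σ ∧ ∃ (A : Set X) (B : Set Y),
      (∀ x y, y ∈ B → r x y = 0 → x ∈ A) ∧ (∀ x ∈ A, ∑ y, σ x y = μ x) ∧
      (∀ y ∉ B, ∑ x, σ x y = ν y) ∧ ∀ x ∈ A, ∀ y ∉ B, σ x y = 0 := by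
  classical
  obtain ⟨σ, hσ, hmax, hB⟩ := exists_max r hμ0 hν0
  refine ⟨σ, hσ, {x | ∃ y, ∑ x, σ x y < ν y ∧ r x y = 0}, {y | ∑ x, σ x y < ν y},
    fun x y hy hr => ⟨y, hy, hr⟩, ?_, fun y hy => (hσ.2.2.2 y).antisymm (not_lt.1 hy), ?_⟩
  · rintro x ⟨y, hy, hr⟩
    by_contra hne
    have hx : ∑ y, σ x y < μ x := lt_of_le_of_ne (hσ.2.2.1 x) hne
    obtain ⟨ε, hε, hε'⟩ := exists_between (lt_min (sub_pos.2 hx) (sub_pos.2 hy))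
    rw [lt_min_iff] at hε'
    have hτ := hσ.add_ite_row (x₀ := x) (d := fun y' => if y' = y then ε else 0)
      (fun y' => add_nonneg (hσ.1 x y') (by split_ifs <;> linarith))
      (fun y' h => if_neg (by rintro rfl; exact h hr))
      (by simp only [Finset.sum_ite_eq', Finset.mem_univ, if_true]; linarith)
      (fun y' => by
        split_ifs with h
        · subst h; linarith
        · simpa using hσ.2.2.2 y')
    have hle := hmax _ hτ
    rw [Finset.sum_congr rfl fun x' _ => sum_add_ite_row σ x _ x', Finset.sum_add_distrib] at hle
    simp only [Finset.sum_ite_eq', Finset.mem_univ, if_true] at hle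
    linarith
  · rintro x ⟨y, hy, hr⟩ z hz
    by_contra hne
    have hxz : 0 < σ x z := lt_of_le_of_ne (hσ.1 x z) (Ne.symm hne)
    have hzy : z ≠ y := by rintro rfl; exact hz hy
    obtain ⟨ε, hε, hε'⟩ := exists_between (lt_min hxz (sub_pos.2 hy))
    rw [lt_min_iff] at hε'
    set d : Y → ℝ := fun y' => (if y' = y then ε else 0) - if y' = z then ε else 0 with hd
    have hdsum : ∑ y, d y = 0 := by simp [hd]
    have hdy : d y = ε := by simp [hd, hzy.symm]
    have hdz : d z = -ε := by simp [hd, hzy]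
    have hd0 : ∀ y', y' ≠ y → y' ≠ z → d y' = 0 := fun y' h h' => by simp [hd, h, h']
    have hτ := hσ.add_ite_row (x₀ := x) (d := d)
      (fun y' => by
        have := hσ.1 x y'
        by_cases h : y' = y
        · subst h; linarith
        by_cases h' : y' = z
        · subst h'; linarith
        rw [hd0 y' h h']; linarith)
      (fun y' h => hd0 y' (by rintro rfl; exact h hr)
        (by rintro rfl; exact hne (hσ.2.1 _ _ h)))
      (by rw [hdsum, add_zero]; exact hσ.2.2.1 x)
      (fun y' => by
        have := hσ.2.2.2 y'
        by_cases h : y' = y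
        · subst h; linarith
        by_cases h' : y' = z
        · subst h'; linarith
        rw [hd0 y' h h']; linarith)
    refine hz (hB _ hτ (by simp [sum_add_ite_row, hdsum]) (fun y' hy' => ?_) ?_)
    · simp only [Set.mem_ofPred_eq, sum_add_ite_col] at hy' ⊢
      by_cases h : y' = y
      · subst h; linarith
      by_cases h' : y' = z
      · subst h'; linarith
      rw [hd0 y' h h']; linarith
    · have := hσ.2.2.2 z
      simp only [Set.mem_ofPred_eq, sum_add_ite_col]
      linarith

/-- A subcoupling of mass `m` extends to a coupling of cost at most `1 - m`. -/
theorem exists_coupling {σ : X → Y → ℝ} (hσ : IsZeroSubcoupling r μ ν σ)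
    (hr : ∀ x y, r x y ≤ 1) (hμ1 : ∑ x, μ x = 1) (hν1 : ∑ y, ν y = 1) :
    ∃ ρ : X × Y → ℝ, (∀ p, 0 ≤ ρ p) ∧
      (∀ x, ∑ y, ρ (x, y) = μ x) ∧ (∀ y, ∑ x, ρ (x, y) = ν y) ∧
      ∑ p : X × Y, ρ p * r p.1 p.2 ≤ 1 - ∑ x, ∑ y, σ x y := by
  obtain ⟨h0, hs, hrow, hcol⟩ := hσ
  set m := ∑ x, ∑ y, σ x y with hm
  set a : X → ℝ := fun x => μ x - ∑ y, σ x y with ha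
  set b : Y → ℝ := fun y => ν y - ∑ x, σ x y with hb
  have ha0 : ∀ x, 0 ≤ a x := fun x => sub_nonneg.2 (hrow x)
  have hb0 : ∀ y, 0 ≤ b y := fun y => sub_nonneg.2 (hcol y)
  have hasum : ∑ x, a x = 1 - m := by simp only [ha, Finset.sum_sub_distrib, hμ1, hm]
  have hbsum : ∑ y, b y = 1 - m := by
    simp only [hb, Finset.sum_sub_distrib, hν1, hm]
    rw [Finset.sum_comm]
  have hm1 : 0 ≤ 1 - m := hasum ▸ Finset.sum_nonneg fun x _ => ha0 x
  have hadiv : ∀ x, a x * (1 - m) / (1 - m) = a x := fun x => mul_div_cancel_of_imp fun h =>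
    (Finset.sum_eq_zero_iff_of_nonneg fun x _ => ha0 x).1 (hasum.trans h) x (Finset.mem_univ x)
  have hbdiv : ∀ y, (1 - m) * b y / (1 - m) = b y := fun y => by
    rw [mul_comm]
    exact mul_div_cancel_of_imp fun h =>
      (Finset.sum_eq_zero_iff_of_nonneg fun y _ => hb0 y).1 (hbsum.trans h) y (Finset.mem_univ y)
  have hab0 : ∀ x y, 0 ≤ a x * b y / (1 - m) := fun x y =>
    div_nonneg (mul_nonneg (ha0 x) (hb0 y)) hm1
  refine ⟨fun p => σ p.1 p.2 + a p.1 * b p.2 / (1 - m),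
    fun p => add_nonneg (h0 _ _) (hab0 _ _), fun x => ?_, fun y => ?_, ?_⟩
  · dsimp only
    rw [Finset.sum_add_distrib, ← Finset.sum_div, ← Finset.mul_sum, hbsum, hadiv]
    simp [ha]
  · dsimp only
    rw [Finset.sum_add_distrib, ← Finset.sum_div, ← Finset.sum_mul, hasum, hbdiv]
    simp [hb]
  · calc ∑ p : X × Y, (σ p.1 p.2 + a p.1 * b p.2 / (1 - m)) * r p.1 p.2
        ≤ ∑ p : X × Y, a p.1 * b p.2 / (1 - m) := by
          refine Finset.sum_le_sum fun p _ => ?_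
          have hσr : σ p.1 p.2 * r p.1 p.2 = 0 := by
            by_cases h : r p.1 p.2 = 0
            · rw [h, mul_zero]
            · rw [hs _ _ h, zero_mul]
          rw [add_mul, hσr, zero_add]
          exact mul_le_of_le_one_right (hab0 _ _) (hr _ _)
      _ = ∑ x, a x := by
          rw [Fintype.sum_prod_type]
          refine Finset.sum_congr rfl fun x _ => ?_
          dsimp only
          rw [← Finset.sum_div, ← Finset.mul_sum, hbsum, hadiv]
      _ = 1 - m := hasum

end IsZeroSubcoupling

theorem crisp_price_functions {X Y : Type*} [Fintype X] [Fintype Y]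
    (r : X → Y → ℝ) (hr : ∀ x y, r x y = 0 ∨ r x y = 1)
    (μ : X → ℝ) (hμ0 : ∀ x, 0 ≤ μ x) (hμ1 : ∑ x, μ x = 1)
    (ν : Y → ℝ) (hν0 : ∀ y, 0 ≤ ν y) (hν1 : ∑ y, ν y = 1) :
    ∃ f : X → ℝ, ∃ g : Y → ℝ,
      (∀ x, f x = 0 ∨ f x = 1) ∧ (∀ y, g y = 0 ∨ g y = 1) ∧
      (∀ x y, g y - f x ≤ r x y) ∧
      (∑ y, ν y * g y) - (∑ x, μ x * f x) ≥
        sInf {v : ℝ | ∃ ρ : X × Y → ℝ, (∀ p, 0 ≤ ρ p) ∧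
          (∀ x, ∑ y, ρ (x, y) = μ x) ∧ (∀ y, ∑ x, ρ (x, y) = ν y) ∧
          v = ∑ p : X × Y, ρ p * r p.1 p.2} := by
  classical
  have hr0 : ∀ x y, 0 ≤ r x y := fun x y => by rcases hr x y with h | h <;> simp [h]
  have hr1 : ∀ x y, r x y ≤ 1 := fun x y => by rcases hr x y with h | h <;> simp [h]
  obtain ⟨σ, hσ, A, B, hAB, hA, hB, hσAB⟩ :=
    IsZeroSubcoupling.exists_mass_eq_cut r hμ0 hν0
  obtain ⟨ρ, hρ0, hρμ, hρν, hcost⟩ := hσ.exists_coupling hr1 hμ1 hν1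
  refine ⟨fun x => if x ∈ A then 1 else 0, fun y => if y ∈ B then 1 else 0,
    fun x => by by_cases h : x ∈ A <;> simp [h], fun y => by by_cases h : y ∈ B <;> simp [h],
    fun x y => ?_, ?_⟩
  · dsimp only
    by_cases hy : y ∈ B
    · by_cases hx : x ∈ A
      · simpa [hx, hy] using hr0 x y
      · simp [hx, hy, (hr x y).resolve_left fun h => hx (hAB x y hy h)]
    · rw [if_neg hy]
      have := hr0 x y
      split_ifs <;> linarith
  · refine ge_iff_le.2 ((csInf_le ?_ ?_).trans (hcost.trans ?_))
    · refine ⟨0, ?_⟩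
      rintro _ ⟨ρ', h, -, -, rfl⟩
      exact Finset.sum_nonneg fun p _ => mul_nonneg (h p) (hr0 _ _)
    · exact ⟨ρ, hρ0, hρμ, hρν, rfl⟩
    have hf : ∑ x, μ x * (if x ∈ A then (1 : ℝ) else 0) =
        ∑ x, ∑ y, σ x y * if x ∈ A then 1 else 0 :=
      Finset.sum_congr rfl fun x _ => by
        by_cases h : x ∈ A <;> simp [h, hA]
    have hg : 1 - ∑ y, ν y * (if y ∈ B then (1 : ℝ) else 0) =
        ∑ x, ∑ y, σ x y * if y ∈ B then 0 else 1 := by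
      rw [Finset.sum_comm]
      nth_rw 1 [← hν1]
      rw [← Finset.sum_sub_distrib]
      exact Finset.sum_congr rfl fun y _ => by
        by_cases h : y ∈ B <;> simp [h, hB]
    have hmass : ∑ x, ∑ y, σ x y = (∑ x, ∑ y, σ x y * if x ∈ A then 1 else 0) +
        ∑ x, ∑ y, σ x y * if y ∈ B then 0 else 1 := by
      simp only [← Finset.sum_add_distrib]
      refine Finset.sum_congr rfl fun x _ => Finset.sum_congr rfl fun y _ => ?_
      by_cases hx : x ∈ A <;> by_cases hy : y ∈ B
      · simp [hx, hy]
      · simp [hσAB x hx y hy]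
      · simp [hσ.2.1 x y fun h => hx (hAB x y hy h)]
      · simp [hx, hy]
    linarith
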